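/- E(ℚ) is isomorphic as an abelian group to (ℤ/2ℤ) × ℤ². -/

import Mathlib

/-- The elliptic curve `y² = x³ − 5(m+16n²)x² + 4(m+16n²)(m+25n²)x` over `ℚ`. -/
def zywinaCurve (m n : ℕ) : WeierstrassCurve ℚ where
  a₁ := 0
  a₂ := -(5 * ((m : ℚ) + 16 * n ^ 2))
  a₃ := 0
  a₄ := 4 * ((m : ℚ) + 16 * n ^ 2) * ((m : ℚ) + 25 * n ^ 2)
  a₆ := 0

open WeierstrassCurve

/-- The Weierstrass curve `y² = x³ + ax² + bx`. -/
def twoTorsionCurve (a b : ℚ) : WeierstrassCurve ℚ where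
  a₁ := 0
  a₂ := a
  a₃ := 0
  a₄ := b
  a₆ := 0

namespace twoTorsionCurve

variable {a b : ℚ}

lemma equation_iff {x y : ℚ} :
    (twoTorsionCurve a b).toAffine.Equation x y ↔ y ^ 2 = x ^ 3 + a * x ^ 2 + b * x := by
  simp [Affine.equation_iff, twoTorsionCurve]

lemma Δ_ne_zero (hb : b ≠ 0) (hd : a ^ 2 - 4 * b ≠ 0) : (twoTorsionCurve a b).Δ ≠ 0 := by
  have : (twoTorsionCurve a b).Δ = 16 * b ^ 2 * (a ^ 2 - 4 * b) := by
    simp [twoTorsionCurve, WeierstrassCurve.Δ, b₂, b₄, b₆, b₈]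
    ring
  rw [this]
  positivity

lemma nonsingular (hb : b ≠ 0) (hd : a ^ 2 - 4 * b ≠ 0) {x y : ℚ}
    (h : y ^ 2 = x ^ 3 + a * x ^ 2 + b * x) : (twoTorsionCurve a b).toAffine.Nonsingular x y :=
  (Affine.equation_iff_nonsingular_of_Δ_ne_zero (Δ_ne_zero hb hd)).mp (equation_iff.mpr h)

lemma eq_of_nonsingular {x y : ℚ} (h : (twoTorsionCurve a b).toAffine.Nonsingular x y) :
    y ^ 2 = x ^ 3 + a * x ^ 2 + b * x :=
  equation_iff.mp h.1

lemma negY_eq (x y : ℚ) : (twoTorsionCurve a b).toAffine.negY x y = -y := by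
  simp [Affine.negY, twoTorsionCurve]

lemma some_congr {x y x' y' : ℚ} (h : (twoTorsionCurve a b).toAffine.Nonsingular x y)
    (hx : x = x') (hy : y = y') : ∃ h', Affine.Point.some x y h = Affine.Point.some x' y' h' := by
  subst hx hy
  exact ⟨h, rfl⟩

lemma neg_some {x y : ℚ} (h : (twoTorsionCurve a b).toAffine.Nonsingular x y) :
    ∃ h', -Affine.Point.some x y h = Affine.Point.some x (-y) h' := by
  rw [Affine.Point.neg_some]
  exact some_congr _ rfl (negY_eq x y)

/-- The chord construction: `l` is the slope of the line through two points. -/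
lemma some_add_some {x₁ y₁ x₂ y₂ : ℚ} (h₁ : (twoTorsionCurve a b).toAffine.Nonsingular x₁ y₁)
    (h₂ : (twoTorsionCurve a b).toAffine.Nonsingular x₂ y₂) (hx : x₁ ≠ x₂) {l x y : ℚ}
    (hl : l = (y₁ - y₂) / (x₁ - x₂)) (hx' : x = l ^ 2 - a - x₁ - x₂)
    (hy' : y = -(l * (x - x₁) + y₁)) :
    ∃ h, Affine.Point.some x₁ y₁ h₁ + Affine.Point.some x₂ y₂ h₂ = Affine.Point.some x y h := by
  rw [Affine.Point.add_of_X_ne hx]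
  have hX : (twoTorsionCurve a b).toAffine.addX x₁ x₂
      ((twoTorsionCurve a b).toAffine.slope x₁ x₂ y₁ y₂) = x := by
    rw [Affine.slope_of_X_ne hx, ← hl, hx']
    simp [Affine.addX, twoTorsionCurve]
  have hY : (twoTorsionCurve a b).toAffine.addY x₁ x₂ y₁
      ((twoTorsionCurve a b).toAffine.slope x₁ x₂ y₁ y₂) = y := by
    rw [Affine.addY, Affine.negAddY, hX, Affine.slope_of_X_ne hx, ← hl, hy', negY_eq]
  exact some_congr _ hX hY

lemma some_add_self {x₁ y₁ : ℚ} (h₁ : (twoTorsionCurve a b).toAffine.Nonsingular x₁ y₁)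
    (hy : y₁ ≠ 0) :
    ∃ y h, Affine.Point.some x₁ y₁ h₁ + Affine.Point.some x₁ y₁ h₁ =
      Affine.Point.some (((x₁ ^ 2 - b) / (2 * y₁)) ^ 2) y h := by
  have hy' : y₁ ≠ (twoTorsionCurve a b).toAffine.negY x₁ y₁ := by
    rw [negY_eq]
    contrapose! hy
    linarith
  rw [Affine.Point.add_self_of_Y_ne hy']
  have hX : (twoTorsionCurve a b).toAffine.addX x₁ x₁
      ((twoTorsionCurve a b).toAffine.slope x₁ x₁ y₁ y₁) = ((x₁ ^ 2 - b) / (2 * y₁)) ^ 2 := by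
    rw [Affine.slope_of_Y_ne rfl hy', negY_eq]
    simp only [Affine.addX, twoTorsionCurve]
    have := eq_of_nonsingular h₁
    have h2 : y₁ - -y₁ ≠ 0 := by contrapose! hy; linarith
    field_simp
    grind
  exact ⟨_, some_congr _ hX rfl⟩

lemma some_add_self_eq_zero {x₁ y₁ : ℚ} (h₁ : (twoTorsionCurve a b).toAffine.Nonsingular x₁ y₁)
    (hy : y₁ = 0) : Affine.Point.some x₁ y₁ h₁ + Affine.Point.some x₁ y₁ h₁ = 0 := by
  apply Affine.Point.add_self_of_Y_eq
  rw [negY_eq, hy, neg_zero]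

/-! ### The approximate parallelogram law -/

open Height MvPolynomial

lemma sym2x_add_sub (hb : b ≠ 0) (hd : a ^ 2 - 4 * b ≠ 0)
    (P Q : (twoTorsionCurve a b).toAffine.Point) :
    ∃ c : ℚ, c ≠ 0 ∧
      (fun i ↦ (addSubMap (twoTorsionCurve a b) i).eval (P.sym2x Q)) =
        c • (P + Q).sym2x (P - Q) := by
  have key : ∀ s t u : ℚ, (fun i ↦ (addSubMap (twoTorsionCurve a b) i).eval ![s, t, u]) =
      ![s ^ 2 - 2 * b * s * u + b ^ 2 * u ^ 2, 2 * t * s + 4 * a * s * u + 2 * b * t * u,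
        t ^ 2 - 4 * s * u] := by
    intro s t u
    ext i
    fin_cases i <;> simp [addSubMap, twoTorsionCurve, b₂, b₄, b₆, b₈]
  have hself : ∀ {x y : ℚ} (h : (twoTorsionCurve a b).toAffine.Nonsingular x y),
      ∃ c : ℚ, c ≠ 0 ∧
      (fun i ↦ (addSubMap (twoTorsionCurve a b) i).eval ![x * x, x + x, 1]) =
        c • (Affine.Point.some x y h + Affine.Point.some x y h).sym2x 0 := by
    intro x y h
    have e := eq_of_nonsingular h
    rcases eq_or_ne y 0 with rfl | hy
    · rw [some_add_self_eq_zero h rfl, key, Affine.Point.sym2x_zero_zero]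
      refine ⟨(x ^ 2 - b) ^ 2, ?_, ?_⟩
      · intro h0
        have h1 : x ^ 2 = b := by simpa [sub_eq_zero] using h0
        have hx : x ≠ 0 := by rintro rfl; apply hb; linarith
        have h2 : 2 * x + a = 0 := by
          have : x ^ 2 * (2 * x + a) = 0 := by rw [← h1] at e; linarith
          simpa [hx] using this
        apply hd
        rw [← h1, show a = -2 * x by linarith]
        ring
      · ext i
        fin_cases i
        · simp; ring
        · simp; linear_combination (-4) * e
        · simp; ring
    · obtain ⟨y', h', e'⟩ := some_add_self h hy
      rw [e', key, Affine.Point.sym2x_some_zero]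
      refine ⟨4 * y ^ 2, by positivity, ?_⟩
      ext i
      fin_cases i
      · simp; field_simp; ring
      · simp; linear_combination (-4) * e
      · simp; ring
  match P, Q with
  | 0, 0 => exact ⟨1, one_ne_zero, by rw [Affine.Point.sym2x_zero_zero, key]; simp⟩
  | .some x y h, 0 =>
    refine ⟨1, one_ne_zero, ?_⟩
    rw [Affine.Point.sym2x_some_zero, key, add_zero, sub_zero, Affine.Point.sym2x_some_some]
    ext i; fin_cases i <;> simp <;> ring
  | 0, .some x y h =>
    refine ⟨1, one_ne_zero, ?_⟩
    rw [Affine.Point.sym2x_zero_some, key, zero_add, zero_sub, Affine.Point.sym2x_neg_right,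
      Affine.Point.sym2x_some_some]
    ext i; fin_cases i <;> simp <;> ring
  | .some x₁ y₁ h₁, .some x₂ y₂ h₂ =>
    by_cases hx : x₁ = x₂
    · rcases Affine.Point.X_eq_iff (h₁ := h₁) (h₂ := h₂).mp hx with h | h
      · rw [h, sub_self, Affine.Point.sym2x_some_some]
        exact hself h₂
      · rw [h, neg_add_cancel, Affine.Point.sym2x_neg_left, Affine.Point.sym2x_comm 0,
          show -Affine.Point.some x₂ y₂ h₂ - Affine.Point.some x₂ y₂ h₂ =
            -(Affine.Point.some x₂ y₂ h₂ + Affine.Point.some x₂ y₂ h₂) by abel,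
          Affine.Point.sym2x_neg_left, Affine.Point.sym2x_some_some]
        exact hself h₂
    · obtain ⟨h', e'⟩ := some_add_some h₁ h₂ hx rfl rfl rfl
      obtain ⟨hn, en⟩ := neg_some h₂
      obtain ⟨h'', e''⟩ := some_add_some h₁ hn hx rfl rfl rfl
      rw [sub_eq_add_neg, en, e', e'', Affine.Point.sym2x_some_some, Affine.Point.sym2x_some_some,
        key]
      have hx0 : x₁ - x₂ ≠ 0 := sub_ne_zero.mpr hx
      have e₁ := eq_of_nonsingular h₁
      have e₂ := eq_of_nonsingular h₂
      refine ⟨(x₁ - x₂) ^ 2, by positivity, ?_⟩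
      ext i
      fin_cases i
      · simp
        field_simp
        grind
      · simp
        field_simp
        grind
      · simp
        ring

/-- The naive logarithmic height of a point, that is, the height of its `x`-coordinate. -/
noncomputable def naiveHeight (P : (twoTorsionCurve a b).toAffine.Point) : ℝ :=
  logHeight P.xRep

lemma finite_naiveHeight_le (B : ℝ) :
    {P : (twoTorsionCurve a b).toAffine.Point | naiveHeight P ≤ B}.Finite := by
  have hfin : {x : ℚ | logHeight₁ x ≤ B}.Finite := Northcott.finite_le B
  have hrep : ({v : Fin 2 → ℚ | ∃ P : (twoTorsionCurve a b).toAffine.Point,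
      naiveHeight P ≤ B ∧ P.xRep = v}).Finite := by
    refine ((hfin.image (fun x ↦ ![x, 1])).union (Set.finite_singleton ![1, 0])).subset ?_
    rintro v ⟨P, hP, rfl⟩
    match P with
    | 0 => right; simp
    | .some x y h =>
      left
      refine ⟨x, ?_, by simp⟩
      simpa [naiveHeight, logHeight₁_eq_logHeight] using hP
  refine Set.Finite.of_finite_fibers (fun P ↦ P.xRep) (hrep.subset ?_) ?_
  · rintro v ⟨P, hP, rfl⟩
    exact ⟨P, hP, rfl⟩
  · rintro v ⟨P, hP, rfl⟩
    refine (Set.toFinite {P, -P}).subset ?_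
    rintro Q ⟨-, hQ⟩
    exact Affine.Point.xRep_eq_xRep_iff.mp hQ

lemma exists_naiveHeight_parallelogram (hb : b ≠ 0) (hd : a ^ 2 - 4 * b ≠ 0) :
    ∃ C, ∀ P Q : (twoTorsionCurve a b).toAffine.Point,
      |naiveHeight (P + Q) + naiveHeight (P - Q) - 2 * (naiveHeight P + naiveHeight Q)| ≤ C := by
  have : (twoTorsionCurve a b).IsElliptic :=
    ⟨(Δ_ne_zero hb hd).isUnit⟩
  obtain ⟨C₁, h₁⟩ := abs_logHeight_addSubMap_sub_two_mul_logHeight_le (twoTorsionCurve a b)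
  obtain ⟨C₂, h₂⟩ := Height.abs_logHeight_sym2_sub_le ℚ
  have h₃ : ∀ P Q : (twoTorsionCurve a b).toAffine.Point,
      |logHeight (P.sym2x Q) - (naiveHeight P + naiveHeight Q)| ≤ C₂ := by
    intro P Q
    have e : ∀ R : (twoTorsionCurve a b).toAffine.Point, ![R.xRep 0, R.xRep 1] = R.xRep := by
      intro R; ext i; fin_cases i <;> rfl
    have := h₂ (a := P.xRep 0) (b := P.xRep 1) (c := Q.xRep 0) (d := Q.xRep 1)
      (by rw [e]; exact Affine.Point.xRep_ne_zero _) (by rw [e]; exact Affine.Point.xRep_ne_zero _)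
    rw [e, e] at this
    exact this
  refine ⟨C₁ + 3 * C₂, fun P Q ↦ ?_⟩
  obtain ⟨c, hc, e⟩ := sym2x_add_sub hb hd P Q
  have h := h₁ (P.sym2x Q)
  rw [e, logHeight_smul_eq_logHeight _ hc] at h
  have h4 := h₃ P Q
  have h5 := h₃ (P + Q) (P - Q)
  rw [abs_le] at *
  constructor <;> linarith

theorem fg_of_finiteIndex (hb : b ≠ 0) (hd : a ^ 2 - 4 * b ≠ 0)
    (h : (nsmulAddMonoidHom (α := (twoTorsionCurve a b).toAffine.Point) 2).range.FiniteIndex) :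
    AddGroup.FG (twoTorsionCurve a b).toAffine.Point := by
  obtain ⟨C, hC⟩ := exists_naiveHeight_parallelogram hb hd
  have : Northcott (naiveHeight (a := a) (b := b)) := ⟨finite_naiveHeight_le⟩
  exact AddCommGroup.fg_of_descent' (h := naiveHeight) (C := C) h (fun P ↦ logHeight_nonneg _) hC

/-! ### Divisibility by two -/

/-- If a point is a double, then its `x`-coordinate is the square of `X`, and `S ^ 2` is the
`x`-coordinate of a preimage under the dual isogeny. -/
lemma exists_of_add_self {x y : ℚ} {h : (twoTorsionCurve a b).toAffine.Nonsingular x y}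
    {Q : (twoTorsionCurve a b).toAffine.Point} (hQ : Q + Q = Affine.Point.some x y h) :
    ∃ X S : ℚ, x = X ^ 2 ∧ S ≠ 0 ∧ 4 * x * S ^ 2 = (S ^ 2 - a) ^ 2 - 4 * b := by
  match Q with
  | 0 => simp at hQ
  | .some u v h' =>
    have hv : v ≠ 0 := by
      rintro rfl
      rw [some_add_self_eq_zero h' rfl] at hQ
      simp at hQ
    have e := eq_of_nonsingular h'
    obtain ⟨y', h'', e'⟩ := some_add_self h' hv
    rw [e', Affine.Point.some.injEq] at hQ
    have hu : u ≠ 0 := by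
      rintro rfl
      apply hv
      simpa using e
    refine ⟨_, v / u, hQ.1.symm, by positivity, ?_⟩
    rw [← hQ.1]
    field_simp
    rw [e]
    ring

lemma exists_add_self (hb : b ≠ 0) (hd : a ^ 2 - 4 * b ≠ 0) {X S x y : ℚ}
    (h : (twoTorsionCurve a b).toAffine.Nonsingular x y) (hx : x = X ^ 2)
    (hS : 4 * x * S ^ 2 = (S ^ 2 - a) ^ 2 - 4 * b) :
    ∃ Q, Q + Q = Affine.Point.some x y h := by
  have hS0 : S ≠ 0 := by
    rintro rfl
    apply hd
    linear_combination -hS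
  set u := (S ^ 2 - a) / 2 + S * X with hu
  have hu1 : u ^ 2 + b = u * (S ^ 2 - a) := by
    rw [hu]
    linear_combination (1 / 4 : ℚ) * hS + (-S ^ 2) * hx
  have hu0 : u ≠ 0 := by
    intro h0
    rw [h0] at hu1
    apply hb
    linarith
  have heq : (u * S) ^ 2 = u ^ 3 + a * u ^ 2 + b * u := by linear_combination -u * hu1
  have hv : u * S ≠ 0 := by positivity
  obtain ⟨y', h', e⟩ := some_add_self (nonsingular hb hd heq) hv
  have hx' : ((u ^ 2 - b) / (2 * (u * S))) ^ 2 = x := by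
    have : u ^ 2 - b = 2 * (u * S) * X := by linear_combination 2 * u * hu - hu1
    rw [this, hx]
    field_simp
  rcases Affine.Point.X_eq_iff (h₁ := h') (h₂ := h).mp hx' with h1 | h1
  · exact ⟨_, e.trans h1⟩
  · exact ⟨-_, by rw [← neg_add, e, h1, neg_neg]⟩

lemma some_add_origin {x y : ℚ} (h : (twoTorsionCurve a b).toAffine.Nonsingular x y)
    (h₀ : (twoTorsionCurve a b).toAffine.Nonsingular 0 0) (hx : x ≠ 0) :
    ∃ h', Affine.Point.some x y h + Affine.Point.some 0 0 h₀ =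
      Affine.Point.some (b / x) (-(b * y / x ^ 2)) h' := by
  have e := eq_of_nonsingular h
  refine some_add_some h h₀ hx rfl ?_ ?_
  · simp only [sub_zero]
    field_simp
    linear_combination -e
  · field_simp
    ring

lemma exists_some_add_some_mul {x₁ y₁ x₂ y₂ : ℚ}
    (h₁ : (twoTorsionCurve a b).toAffine.Nonsingular x₁ y₁)
    (h₂ : (twoTorsionCurve a b).toAffine.Nonsingular x₂ y₂) (hx : x₁ ≠ x₂) :
    ∃ x y h k, Affine.Point.some x₁ y₁ h₁ + Affine.Point.some x₂ y₂ h₂ =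
      Affine.Point.some x y h ∧ x * (x₁ * x₂) = k ^ 2 := by
  obtain ⟨h, e⟩ := some_add_some h₁ h₂ hx rfl rfl rfl
  refine ⟨_, _, h, (y₁ * x₂ - y₂ * x₁) / (x₁ - x₂), e, ?_⟩
  have hx0 : x₁ - x₂ ≠ 0 := sub_ne_zero.mpr hx
  have e₁ := eq_of_nonsingular h₁
  have e₂ := eq_of_nonsingular h₂
  field_simp
  grind

/-- The product formula for the dual descent map, in the case that the product is trivial. -/
lemma exists_add_self_of_mul_eq_sq (hb : b ≠ 0) (hd : a ^ 2 - 4 * b ≠ 0) {X Z U V s t k : ℚ}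
    (h₁ : (twoTorsionCurve a b).toAffine.Nonsingular (X ^ 2) (X * Z))
    (h₂ : (twoTorsionCurve a b).toAffine.Nonsingular (U ^ 2) (U * V)) (hX : X ≠ 0) (hU : U ≠ 0)
    (hXU : X ^ 2 ≠ U ^ 2) (hs : s = 2 * X ^ 2 + a + 2 * Z) (ht : t = 2 * U ^ 2 + a + 2 * V)
    (hk : s * t = k ^ 2) :
    ∃ Q, Q + Q = Affine.Point.some _ _ h₁ + Affine.Point.some _ _ h₂ := by
  have hZ : Z ^ 2 = X ^ 4 + a * X ^ 2 + b := by
    have := eq_of_nonsingular h₁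
    have h2 : X ^ 2 ≠ 0 := by positivity
    apply mul_left_cancel₀ h2
    linear_combination this
  have hV : V ^ 2 = U ^ 4 + a * U ^ 2 + b := by
    have := eq_of_nonsingular h₂
    have h2 : U ^ 2 ≠ 0 := by positivity
    apply mul_left_cancel₀ h2
    linear_combination this
  have hs' : 4 * X ^ 2 * s = (s - a) ^ 2 - 4 * b := by rw [hs]; linear_combination (-4) * hZ
  have ht' : 4 * U ^ 2 * t = (t - a) ^ 2 - 4 * b := by rw [ht]; linear_combination (-4) * hV
  have hs0 : s ≠ 0 := by
    rintro rfl
    apply hd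
    linear_combination -hs'
  have ht0 : t ≠ 0 := by
    rintro rfl
    apply hd
    linear_combination -ht'
  have hst : s - t ≠ 0 := by
    intro h
    apply hXU
    obtain rfl : s = t := by linarith
    apply mul_left_cancel₀ hs0
    linear_combination (hs' - ht') / 4
  have hm : X - U ≠ 0 := by
    intro h
    apply hXU
    rw [show X = U by linarith]
  have hp : X + U ≠ 0 := by
    intro h
    apply hXU
    rw [show X = -U by linarith]
    ring
  have hm' : X ^ 2 - U ^ 2 ≠ 0 := sub_ne_zero.mpr hXU
  obtain ⟨h, e⟩ := some_add_some h₁ h₂ hXU rfl rfl rfl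
  rw [e]
  have hbd : (-2 * a) ^ 2 - 4 * (a ^ 2 - 4 * b) ≠ 0 := by
    contrapose! hb
    linarith
  have n₁ : (twoTorsionCurve (-2 * a) (a ^ 2 - 4 * b)).toAffine.Nonsingular s (2 * X * s) :=
    nonsingular hd hbd (by linear_combination s * hs')
  have n₂ : (twoTorsionCurve (-2 * a) (a ^ 2 - 4 * b)).toAffine.Nonsingular t (2 * U * t) :=
    nonsingular hd hbd (by linear_combination t * ht')
  obtain ⟨h₃, -⟩ := some_add_some n₁ n₂ (sub_ne_zero.mp hst) rfl rfl rfl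
  set l := (2 * X * s - 2 * U * t) / (s - t) with hl
  set r := l ^ 2 - (-2 * a) - s - t with hr
  have e₃ := eq_of_nonsingular h₃
  have hr' : r = 4 * (s * t) * (X - U) ^ 2 / (s - t) ^ 2 := by
    rw [hr, hl]
    field_simp
    grind
  have hr0 : r ≠ 0 := by
    rw [hr']
    positivity
  set W := (Z * U - V * X) / (U ^ 2 - X ^ 2) with hW
  have hm'' : U ^ 2 - X ^ 2 ≠ 0 := sub_ne_zero.mpr hXU.symm
  have hW' : W = l / 2 - 1 / 2 * ((s - t) / (2 * (X - U))) := by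
    have hZs : Z = (s - 2 * X ^ 2 - a) / 2 := by linarith
    have hVt : V = (t - 2 * U ^ 2 - a) / 2 := by linarith
    rw [hW, hl, hZs, hVt, show U ^ 2 - X ^ 2 = -((X - U) * (X + U)) by ring]
    field_simp
    linear_combination (U - X) * (hs' - ht')
  have hw : -(l * (r - s) + 2 * X * s) = -(2 * r * W) := by
    have : 2 * X * s - l * s = -(2 * (s * t) * (X - U) / (s - t)) := by
      rw [hl]
      field_simp
      ring
    have h2 : r * ((s - t) / (2 * (X - U))) = 2 * (s * t) * (X - U) / (s - t) := by
      rw [hr']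
      field_simp
      ring
    rw [hW']
    linear_combination -this - h2
  have hx : ((X * Z - U * V) / (X ^ 2 - U ^ 2)) ^ 2 - a - X ^ 2 - U ^ 2 = W ^ 2 := by
    rw [hW, show U ^ 2 - X ^ 2 = -(X ^ 2 - U ^ 2) by ring]
    field_simp
    linear_combination (X ^ 2 - U ^ 2) * (hZ - hV)
  refine exists_add_self hb hd (X := W) (S := 2 * k * (X - U) / (s - t)) h hx ?_
  have hS : (2 * k * (X - U) / (s - t)) ^ 2 = r := by
    rw [hr', hk]
    field_simp
    ring
  rw [hS, hx]
  rw [hw] at e₃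
  apply mul_left_cancel₀ hr0
  linear_combination e₃

end twoTorsionCurve

lemma Int.exists_squarefree_mul_sq (A : ℤ) : ∃ d M : ℤ, Squarefree d ∧ A = d * M ^ 2 := by
  obtain ⟨d, M, h, hd⟩ := Nat.sq_mul_squarefree A.natAbs
  rcases Int.natAbs_eq A with hA | hA
  · refine ⟨d, M, Int.squarefree_natCast.mpr hd, ?_⟩
    rw [hA, ← h]
    push_cast
    ring
  · refine ⟨-d, M, ?_, ?_⟩
    · rw [← Int.squarefree_natAbs, Int.natAbs_neg, Int.natAbs_natCast]
      exact hd
    · rw [hA, ← h]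
      push_cast
      ring

/-- Lowest terms of the coordinates of a rational point on `y² = x³ + ax² + bx`. -/
lemma Rat.exists_lowest_terms {a b : ℤ} {x y : ℚ} (h : y ^ 2 = x ^ 3 + a * x ^ 2 + b * x) :
    ∃ A C e : ℤ, e ≠ 0 ∧ IsCoprime A e ∧ x = A / (e : ℚ) ^ 2 ∧
      C ^ 2 = A * (A ^ 2 + a * A * e ^ 2 + b * e ^ 4) := by
  set A := x.num with hA
  obtain ⟨D, hD⟩ : ∃ D : ℤ, D = x.den := ⟨_, rfl⟩
  have hD0 : 0 < D := by rw [hD]; exact_mod_cast x.den_pos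
  have hDq : (D : ℚ) ≠ 0 := by exact_mod_cast hD0.ne'
  have hAD : IsCoprime A D := by
    rw [Int.isCoprime_iff_nat_coprime]
    simpa [hD, hA] using x.reduced
  have hx : x = A / D := by
    rw [hA, hD]
    exact_mod_cast (Rat.num_div_den x).symm
  have hy : y ^ 2 = ((A * (A ^ 2 + a * A * D + b * D ^ 2) : ℤ) : ℚ) / ((D ^ 3 : ℤ) : ℚ) := by
    rw [h, hx]
    push_cast
    field_simp
  have hcop : IsCoprime (A * (A ^ 2 + a * A * D + b * D ^ 2)) (D ^ 3) := by
    refine IsCoprime.pow_right (hAD.mul_left ?_)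
    rw [show A ^ 2 + a * A * D + b * D ^ 2 = A ^ 2 + D * (a * A + b * D) by ring]
    exact IsCoprime.add_mul_left_left (hAD.pow_left) _
  have hcop' := Int.isCoprime_iff_nat_coprime.mp hcop
  have hnum : y.num ^ 2 = A * (A ^ 2 + a * A * D + b * D ^ 2) := by
    rw [← Rat.num_pow, hy]
    exact Rat.num_div_eq_of_coprime (by positivity) hcop'
  have hden : (y.den : ℤ) ^ 2 = D ^ 3 := by
    rw [← Rat.den_div_eq_of_coprime (by positivity) hcop', ← hy, Rat.den_pow]
    push_cast
    rfl
  obtain ⟨k, hk⟩ : D ∣ y.den := by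
    rw [← Int.pow_dvd_pow_iff two_ne_zero, hden]
    exact ⟨D, by ring⟩
  have hk2 : D = k ^ 2 := by
    rw [hk] at hden
    apply mul_left_cancel₀ (pow_ne_zero 2 hD0.ne')
    linear_combination -hden
  refine ⟨A, y.num, k, ?_, ?_, ?_, ?_⟩
  · rintro rfl
    simp [hk2] at hD0
  · rw [hk2] at hAD
    exact (IsCoprime.pow_right_iff two_pos).mp hAD
  · rw [hx, hk2]
    push_cast
    rfl
  · rw [hnum, hk2]
    ring

/-- The descent via two-isogeny: the quartic torsor attached to a rational point. -/
lemma Rat.exists_quartic_torsor {a b : ℤ} {x y : ℚ} (hx : x ≠ 0)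
    (h : y ^ 2 = x ^ 3 + a * x ^ 2 + b * x) :
    ∃ d c M e N : ℤ, Squarefree d ∧ b = d * c ∧ M ≠ 0 ∧ e ≠ 0 ∧ IsCoprime (d * M) e ∧
      x = d * ((M : ℚ) / e) ^ 2 ∧ d * M ^ 4 + a * M ^ 2 * e ^ 2 + c * e ^ 4 = N ^ 2 := by
  obtain ⟨A, C, e, he, hAe, hxA, hC⟩ := Rat.exists_lowest_terms h
  obtain ⟨d, M, hd, rfl⟩ := Int.exists_squarefree_mul_sq A
  have hM : M ≠ 0 := by
    rintro rfl
    apply hx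
    simp [hxA]
  have hde : IsCoprime d e := hAe.of_mul_left_left
  have hMe : IsCoprime M e := (IsCoprime.pow_left_iff two_pos).mp hAe.of_mul_left_right
  obtain ⟨C, rfl⟩ : M ∣ C := by
    rw [← Int.pow_dvd_pow_iff two_ne_zero, hC, mul_comm d, mul_assoc]
    exact dvd_mul_right _ _
  have hC' : C ^ 2 = d * (d ^ 2 * M ^ 4 + a * d * M ^ 2 * e ^ 2 + b * e ^ 4) := by
    apply mul_left_cancel₀ (pow_ne_zero 2 hM)
    linear_combination hC
  obtain ⟨N, rfl⟩ : d ∣ C := by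
    refine (hd.dvd_pow_iff_dvd two_ne_zero).mp ?_
    rw [hC']
    exact ⟨_, rfl⟩
  have hN : d * N ^ 2 = d ^ 2 * M ^ 4 + a * d * M ^ 2 * e ^ 2 + b * e ^ 4 := by
    apply mul_left_cancel₀ hd.ne_zero
    linear_combination hC'
  obtain ⟨c, rfl⟩ : d ∣ b := by
    refine (hde.pow_right (n := 4)).dvd_of_dvd_mul_right ?_
    exact ⟨N ^ 2 - d * M ^ 4 - a * M ^ 2 * e ^ 2, by linear_combination -hN⟩
  refine ⟨d, c, M, e, N, hd, rfl, hM, he, hde.mul_left hMe, ?_, ?_⟩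
  · rw [hxA]
    push_cast
    ring
  · apply mul_left_cancel₀ hd.ne_zero
    linear_combination -hN

lemma Int.eq_of_dvd_prime {d q : ℤ} (hq : Prime q) (h : d ∣ q) :
    d = 1 ∨ d = -1 ∨ d = q ∨ d = -q := by
  rcases (Irreducible.dvd_iff hq.irreducible).mp h with h | h
  · rcases Int.isUnit_iff.mp h with h | h <;> simp [h]
  · rcases Int.associated_iff.mp h with h | h <;> simp [h]

lemma Int.eq_of_dvd_prime_mul_prime {d q r : ℤ} (hq : Prime q) (hr : Prime r) (h : d ∣ q * r) :
    ∃ u, (u = 1 ∨ u = -1) ∧ (d = u ∨ d = u * q ∨ d = u * r ∨ d = u * (q * r)) := by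
  obtain ⟨d₁, d₂, h₁, h₂, rfl⟩ := exists_dvd_and_dvd_of_dvd_mul h
  rcases Int.eq_of_dvd_prime hq h₁ with rfl | rfl | rfl | rfl <;>
  rcases Int.eq_of_dvd_prime hr h₂ with rfl | rfl | rfl | rfl <;>
  first
  | (refine ⟨1, ?_⟩; simp; done)
  | (refine ⟨-1, ?_⟩; simp)

lemma Int.dvd_and_dvd_of_dvd_sq_add_sq {q : ℕ} (hq : q.Prime) (hq4 : q % 4 = 3) {x y : ℤ}
    (h : (q : ℤ) ∣ x ^ 2 + y ^ 2) : (q : ℤ) ∣ x ∧ (q : ℤ) ∣ y := by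
  have : Fact q.Prime := ⟨hq⟩
  have hy : (q : ℤ) ∣ y := by
    rw [← ZMod.intCast_zmod_eq_zero_iff_dvd] at h ⊢
    by_contra hy
    push_cast at h
    exact ZMod.mod_four_ne_three_of_sq_eq_neg_sq' hy (eq_neg_of_add_eq_zero_left h) hq4
  refine ⟨?_, hy⟩
  have := (Int.dvd_add_left (dvd_pow hy two_ne_zero)).mp h
  exact (Nat.prime_iff_prime_int.mp hq).dvd_of_dvd_pow this

lemma Int.emod_eight_of_odd_sq {x : ℤ} (h : x % 2 = 1) : x ^ 2 % 8 = 1 := by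
  have : x % 8 = 1 ∨ x % 8 = 3 ∨ x % 8 = 5 ∨ x % 8 = 7 := by omega
  rcases this with h | h | h | h <;> simp [pow_two, Int.mul_emod, h]

section

variable {p q r n : ℕ}

/-- There is no two-adic point on the torsors with even `d`. -/
lemma not_two_dvd_of_torsor {d c M e N : ℤ} (hq8 : q % 8 = 3) (hr8 : r % 8 = 3)
    (hd : Squarefree d) (hdc : 4 * (q : ℤ) * r = d * c) (hde : IsCoprime (d * M) e)
    (h : d * M ^ 4 + -(5 * (q : ℤ)) * M ^ 2 * e ^ 2 + c * e ^ 4 = N ^ 2) : ¬ 2 ∣ d := by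
  rintro ⟨d, rfl⟩
  have hqr : ((q : ℤ) * r) % 8 = 1 := by
    have h1 : (q : ℤ) % 8 = 3 := by omega
    have h2 : (r : ℤ) % 8 = 3 := by omega
    simp [Int.mul_emod, h1, h2]
  have hd2 : d % 2 = 1 := by
    by_contra h2
    obtain ⟨k, rfl⟩ : 2 ∣ d := by omega
    have := hd 2 ⟨k, by ring⟩
    rw [Int.isUnit_iff] at this
    omega
  have hdc' : d * c = 2 * (q * r) := by linarith
  obtain ⟨c, rfl⟩ : 2 ∣ c := by
    have : (2 : ℤ) ∣ d * c := ⟨_, hdc'⟩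
    rcases Int.prime_two.dvd_or_dvd this with h | h
    · omega
    · exact h
  have hdc2 : d * c = q * r := by linarith
  have hc2 : c % 2 = 1 := by
    by_contra h2
    obtain ⟨k, rfl⟩ : 2 ∣ c := by omega
    have : (q : ℤ) * r = 2 * (d * k) := by rw [← hdc2]; ring
    omega
  have he2 : e % 2 = 1 := by
    by_contra h2
    have h3 : (2 : ℤ) ∣ e := by omega
    have := hde.isUnit_of_dvd' (x := 2) ⟨d * M, by ring⟩ h3
    rw [Int.isUnit_iff] at this
    omega
  have he := Int.emod_eight_of_odd_sq he2
  obtain ⟨E, hE⟩ : ∃ E, e ^ 2 = 8 * E + 1 := ⟨e ^ 2 / 8, by omega⟩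
  have hd8 := Int.emod_eight_of_odd_sq hd2
  have hc8 : c % 8 = d % 8 := by
    have : c * d ^ 2 = d * (q * r) := by rw [← hdc2]; ring
    obtain ⟨D, hD⟩ : ∃ D, d ^ 2 = 8 * D + 1 := ⟨d ^ 2 / 8, by omega⟩
    obtain ⟨F, hF⟩ : ∃ D, (q : ℤ) * r = 8 * D + 1 := ⟨q * r / 8, by omega⟩
    rw [hD, hF] at this
    have h2 : c - d = 8 * (d * F - c * D) := by linarith
    omega
  obtain ⟨k, hk⟩ : ∃ k, c = d + 8 * k := ⟨(c - d) / 8, by omega⟩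
  obtain ⟨j, hj⟩ : ∃ j : ℤ, q = 8 * j + 3 := ⟨q / 8, by omega⟩
  obtain ⟨i, hi⟩ : ∃ i : ℤ, d = 2 * i + 1 := ⟨d / 2, by omega⟩
  rw [show e ^ 4 = (e ^ 2) ^ 2 by ring, show M ^ 4 = (M ^ 2) ^ 2 by ring, hE, hk, hj, hi] at h
  rcases Int.emod_two_eq_zero_or_one M with hM | hM
  · obtain ⟨m, rfl⟩ : 2 ∣ M := by omega
    rcases Int.emod_two_eq_zero_or_one N with hN | hN
    · obtain ⟨l, rfl⟩ : 2 ∣ N := by omega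
      ring_nf at h
      omega
    · obtain ⟨l, rfl⟩ : ∃ l, N = 2 * l + 1 := ⟨N / 2, by omega⟩
      ring_nf at h
      omega
  · have hM := Int.emod_eight_of_odd_sq hM
    obtain ⟨m, hm⟩ : ∃ m, M ^ 2 = 8 * m + 1 := ⟨M ^ 2 / 8, by omega⟩
    rw [hm] at h
    rcases Int.emod_two_eq_zero_or_one N with hN | hN
    · obtain ⟨l, rfl⟩ : 2 ∣ N := by omega
      ring_nf at h
      omega
    · have hN := Int.emod_eight_of_odd_sq hN
      obtain ⟨l, hl⟩ : ∃ m, N ^ 2 = 8 * m + 1 := ⟨N ^ 2 / 8, by omega⟩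
      rw [hl] at h
      ring_nf at h
      omega

lemma exists_sq_class_of_equation (hq : q.Prime) (hr : r.Prime) (hq8 : q % 8 = 3)
    (hr8 : r % 8 = 3) {x y : ℚ} (hx : x ≠ 0)
    (h : y ^ 2 = x ^ 3 + -(5 * (q : ℚ)) * x ^ 2 + 4 * q * r * x) :
    ∃ t, t ≠ 0 ∧ (x = t ^ 2 ∨ x = q * t ^ 2 ∨ x = r * t ^ 2 ∨ x = q * r * t ^ 2) := by
  obtain ⟨d, c, M, e, N, hd, hdc, hM, he, hde, hxd, hN⟩ :=
    Rat.exists_quartic_torsor (a := -(5 * (q : ℤ))) (b := 4 * q * r) (y := y) hx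
      (by push_cast; exact h)
  have hq0 : 0 < (q : ℤ) := by exact_mod_cast hq.pos
  have hr0 : 0 < (r : ℤ) := by exact_mod_cast hr.pos
  have hd0 : 0 < d := by
    by_contra h0
    have h1 : d < 0 := lt_of_le_of_ne (not_lt.mp h0) hd.ne_zero
    have h2 : c < 0 := by
      by_contra h2
      have h3 := mul_nonpos_of_nonpos_of_nonneg h1.le (not_lt.mp h2)
      have : 0 < 4 * (q : ℤ) * r := by positivity
      linarith
    have h3 : 0 < M ^ 4 := by positivity
    have h4 : 0 < (q : ℤ) * (M ^ 2 * e ^ 2) := by positivity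
    have h5 : 0 < e ^ 4 := by positivity
    nlinarith [sq_nonneg N]
  have h2d := not_two_dvd_of_torsor hq8 hr8 hd hdc hde hN
  have hdqr : d ∣ q * r := by
    have h4 : IsCoprime d 4 := by
      have := (Int.prime_two.coprime_iff_not_dvd.mpr h2d).symm
      simpa using this.pow_right (n := 2)
    refine h4.dvd_of_dvd_mul_left ⟨c, ?_⟩
    rw [← hdc]
    ring
  have ht : (M : ℚ) / e ≠ 0 := by
    have : (M : ℚ) ≠ 0 := by exact_mod_cast hM
    have : (e : ℚ) ≠ 0 := by exact_mod_cast he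
    positivity
  refine ⟨(M : ℚ) / e, ht, ?_⟩
  rw [hxd]
  have hqr0 : 0 < (q : ℤ) * r := by positivity
  obtain ⟨u, hu, hd⟩ := Int.eq_of_dvd_prime_mul_prime (Nat.prime_iff_prime_int.mp hq)
    (Nat.prime_iff_prime_int.mp hr) hdqr
  obtain rfl : u = 1 := by
    rcases hu with rfl | rfl
    · rfl
    · rcases hd with rfl | rfl | rfl | rfl <;> linarith
  rcases hd with rfl | rfl | rfl | rfl <;> simp

lemma not_three_dvd_of_torsor {d c M e N : ℤ} (hp3 : p % 3 = 2) (hq3 : q % 3 = 2)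
    (hd : Squarefree d) (hdc : 9 * (p : ℤ) * q = d * c) (hde : IsCoprime (d * M) e)
    (h : d * M ^ 4 + 10 * (q : ℤ) * M ^ 2 * e ^ 2 + c * e ^ 4 = N ^ 2) : ¬ 3 ∣ d := by
  rintro ⟨d, rfl⟩
  have h3 : Prime (3 : ℤ) := Int.prime_three
  have hpq : ¬ (3 : ℤ) ∣ p * q := by
    intro h
    rcases h3.dvd_or_dvd h with h | h <;> omega
  have hd3 : ¬ 3 ∣ d := by
    rintro ⟨k, rfl⟩
    have := hd 3 ⟨k, by ring⟩
    rw [Int.isUnit_iff] at this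
    omega
  have he3 : ¬ 3 ∣ e := by
    intro h
    have := hde.isUnit_of_dvd' (x := 3) ⟨d * M, by ring⟩ h
    rw [Int.isUnit_iff] at this
    omega
  have hdc' : d * c = 3 * (p * q) := by linarith
  obtain ⟨c, rfl⟩ : 3 ∣ c := (h3.dvd_or_dvd ⟨_, hdc'⟩).resolve_left hd3
  have hdc2 : d * c = p * q := by linarith
  have sq : ∀ {z : ℤ}, ¬ 3 ∣ z → z ^ 2 % 3 = 1 := by
    intro z hz
    have : z % 3 = 1 ∨ z % 3 = 2 := by omega
    rcases this with h | h <;> simp [pow_two, Int.mul_emod, h]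
  by_cases hM : 3 ∣ M
  · have hN : 3 ∣ N := by
      obtain ⟨m, rfl⟩ := hM
      refine h3.dvd_of_dvd_pow (n := 2) ?_
      rw [← h]
      exact ⟨d * (3 * m) ^ 4 + 10 * q * 3 * m ^ 2 * e ^ 2 + c * e ^ 4, by ring⟩
    obtain ⟨m, rfl⟩ := hM
    obtain ⟨l, rfl⟩ := hN
    have hc : 3 ∣ c * e ^ 4 :=
      ⟨l ^ 2 - 27 * d * m ^ 4 - 10 * q * m ^ 2 * e ^ 2, by linarith⟩
    rcases h3.dvd_or_dvd hc with hc | hc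
    · exact hpq (hdc2 ▸ hc.mul_left d)
    · exact he3 (h3.dvd_of_dvd_pow hc)
  · have h1 := sq hM
    have h2 := sq he3
    have h4 : N ^ 2 % 3 = 2 := by
      have h5 : (10 * (q : ℤ) * M ^ 2 * e ^ 2) % 3 = 2 := by
        have : (q : ℤ) % 3 = 2 := by omega
        simp [Int.mul_emod, this, h1, h2]
      have h6 : N ^ 2 = 10 * (q : ℤ) * M ^ 2 * e ^ 2 + 3 * (d * M ^ 4 + c * e ^ 4) := by
        linarith
      omega
    by_cases hN : 3 ∣ N
    · obtain ⟨l, rfl⟩ := hN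
      ring_nf at h4
      omega
    · have := sq hN
      omega

lemma exists_sq_class_of_dual_equation (hp : p.Prime) (hq : q.Prime) (hp3 : p % 3 = 2)
    (hq3 : q % 3 = 2) (hq4 : q % 4 = 3) (hn : 0 < n) (hqp : q = p + 16 * n ^ 2) {x y : ℚ}
    (hx : x ≠ 0) (h : y ^ 2 = x ^ 3 + 10 * q * x ^ 2 + 9 * p * q * x) :
    ∃ t, t ≠ 0 ∧ (x = t ^ 2 ∨ x = p * q * t ^ 2 ∨ x = -p * t ^ 2 ∨ x = -q * t ^ 2) := by
  obtain ⟨d, c, M, e, N, hd, hdc, hM, he, hde, hxd, hN⟩ :=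
    Rat.exists_quartic_torsor (a := 10 * (q : ℤ)) (b := 9 * p * q) (y := y) hx
      (by push_cast; exact h)
  have h3d := not_three_dvd_of_torsor hp3 hq3 hd hdc hde hN
  have hdpq : d ∣ p * q := by
    have h4 : IsCoprime d 9 := by
      have := (Int.prime_three.coprime_iff_not_dvd.mpr h3d).symm
      simpa using this.pow_right (n := 2)
    refine h4.dvd_of_dvd_mul_left ⟨c, ?_⟩
    rw [← hdc]
    ring
  have ht : (M : ℚ) / e ≠ 0 := by
    have : (M : ℚ) ≠ 0 := by exact_mod_cast hM
    have : (e : ℚ) ≠ 0 := by exact_mod_cast he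
    positivity
  refine ⟨(M : ℚ) / e, ht, ?_⟩
  rw [hxd]
  have hq' := Nat.prime_iff_prime_int.mp hq
  have hp' := Nat.prime_iff_prime_int.mp hp
  have hqp' : (q : ℤ) = p + 16 * n ^ 2 := by exact_mod_cast hqp
  have hq0 : (q : ℤ) ≠ 0 := hq'.ne_zero
  have hp0 : (p : ℤ) ≠ 0 := hp'.ne_zero
  have hqn : ∀ {k : ℤ}, (q : ℤ) ∣ 12 * n * k → (q : ℤ) ∣ k := by
    intro k hk
    refine (hq'.dvd_or_dvd hk).resolve_left fun hk ↦ ?_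
    rcases hq'.dvd_or_dvd hk with hk | hk
    · have : q ∣ 12 := by exact_mod_cast hk
      have := Nat.le_of_dvd (by norm_num) this
      interval_cases q <;> omega
    · have : q ∣ n := by exact_mod_cast hk
      have := Nat.le_of_dvd hn this
      nlinarith [hp.pos]
  have hq3' : ∀ {k : ℤ}, (q : ℤ) ∣ 3 * k → (q : ℤ) ∣ k := by
    intro k hk
    exact hqn (by rw [show 12 * n * k = 4 * n * (3 * k) by ring]; exact hk.mul_left _)
  have not_dvd_e : (q : ℤ) ∣ d * M → ¬ (q : ℤ) ∣ e := by
    intro h1 h2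
    have := hde.isUnit_of_dvd' h1 h2
    exact hq'.not_isUnit this
  have hqp0 : ¬ (q : ℤ) ∣ p := by
    intro hk
    have : q ∣ p := by exact_mod_cast hk
    have := Nat.le_of_dvd hp.pos this
    nlinarith
  obtain ⟨u, hu, hd⟩ := Int.eq_of_dvd_prime_mul_prime hp' hq' hdpq
  rcases hu with rfl | rfl <;> rcases hd with rfl | rfl | rfl | rfl
  · simp
  · exfalso
    obtain rfl : c = 9 * q := by
      apply mul_left_cancel₀ hp0
      linarith
    have h1 : (q : ℤ) ∣ N ^ 2 + (4 * n * M ^ 2) ^ 2 :=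
      ⟨M ^ 4 + 10 * M ^ 2 * e ^ 2 + 9 * e ^ 4, by rw [hqp'] at hN ⊢; linear_combination -hN⟩
    obtain ⟨⟨l, rfl⟩, h2⟩ := Int.dvd_and_dvd_of_dvd_sq_add_sq hq hq4 h1
    have hM : (q : ℤ) ∣ M := by
      refine hq'.dvd_of_dvd_pow (n := 2) (hqn ?_)
      rw [show 12 * n * M ^ 2 = 3 * (4 * n * M ^ 2) by ring]
      exact h2.mul_left _
    refine not_dvd_e (hM.mul_left _) ?_
    obtain ⟨m, rfl⟩ := hM
    refine hq'.dvd_of_dvd_pow (n := 4) (hq3' (hq3' ⟨l ^ 2 - p * q ^ 2 * m ^ 4 -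
      10 * q * m ^ 2 * e ^ 2, ?_⟩))
    apply mul_left_cancel₀ hq0
    linear_combination hN
  · exfalso
    obtain rfl : c = 9 * p := by
      apply mul_left_cancel₀ hq0
      linarith
    have h1 : (q : ℤ) ∣ N ^ 2 + (12 * n * e ^ 2) ^ 2 :=
      ⟨M ^ 4 + 10 * M ^ 2 * e ^ 2 + 9 * e ^ 4, by rw [hqp'] at hN ⊢; linear_combination -hN⟩
    obtain ⟨-, h2⟩ := Int.dvd_and_dvd_of_dvd_sq_add_sq hq hq4 h1
    exact not_dvd_e ⟨M, by ring⟩ (hq'.dvd_of_dvd_pow (n := 2) (hqn h2))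
  · simp
  · exfalso
    obtain rfl : c = -(9 * p * q) := by linarith
    have h1 : (q : ℤ) ∣ N ^ 2 + (M ^ 2) ^ 2 :=
      ⟨10 * M ^ 2 * e ^ 2 - 9 * p * e ^ 4, by linear_combination -hN⟩
    obtain ⟨⟨l, rfl⟩, h2⟩ := Int.dvd_and_dvd_of_dvd_sq_add_sq hq hq4 h1
    have hM : (q : ℤ) ∣ M := hq'.dvd_of_dvd_pow h2
    refine not_dvd_e (hM.mul_left _) ?_
    obtain ⟨m, rfl⟩ := hM
    have h3 : (q : ℤ) ∣ 3 * (3 * (p * e ^ 4)) := by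
      refine ⟨10 * q * m ^ 2 * e ^ 2 - q ^ 2 * m ^ 4 - l ^ 2, ?_⟩
      apply mul_left_cancel₀ hq0
      linear_combination -hN
    exact hq'.dvd_of_dvd_pow ((hq'.dvd_or_dvd (hq3' (hq3' h3))).resolve_left hqp0)
  · simp
  · simp
  · exfalso
    obtain rfl : c = -9 := by
      apply mul_left_cancel₀ (mul_ne_zero hp0 hq0)
      linarith
    have h1 : (q : ℤ) ∣ N ^ 2 + (3 * e ^ 2) ^ 2 :=
      ⟨10 * M ^ 2 * e ^ 2 - p * M ^ 4, by linear_combination -hN⟩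
    obtain ⟨-, h2⟩ := Int.dvd_and_dvd_of_dvd_sq_add_sq hq hq4 h1
    exact not_dvd_e ⟨-p * M, by ring⟩ (hq'.dvd_of_dvd_pow (n := 2) (hq3' h2))

end

lemma Nat.Prime.mul_cast_ne_sq {p q : ℕ} (hp : p.Prime) (hq : q.Prime) (hpq : p < q) (t : ℚ) :
    (p : ℚ) * q ≠ t ^ 2 := by
  intro e
  have : IsSquare ((p * q : ℕ) : ℚ) := ⟨t, by push_cast; rw [e, sq]⟩
  rw [Rat.isSquare_natCast_iff] at this
  obtain ⟨k, hk⟩ := this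
  obtain ⟨l, rfl⟩ : p ∣ k := by
    have : p ∣ k * k := ⟨q, hk.symm⟩
    rcases hp.dvd_mul.mp this with h | h <;> exact h
  have : p ∣ q := ⟨l * l, by
    apply Nat.eq_of_mul_eq_mul_left hp.pos
    rw [hk]
    ring⟩
  exact hpq.ne ((Nat.prime_dvd_prime_iff_eq hp hq).mp this)

/-- The arithmetic conditions under which both two-isogeny descents are computed below. -/
structure DescentTriple (p q r n : ℕ) : Prop where
  prime_p : p.Prime
  prime_q : q.Prime
  prime_r : r.Prime
  n_pos : 0 < n
  q_eq : q = p + 16 * n ^ 2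
  r_eq : r = q + 9 * n ^ 2
  p_mod_three : p % 3 = 2
  q_mod_three : q % 3 = 2
  q_mod_eight : q % 8 = 3
  r_mod_eight : r % 8 = 3

namespace DescentTriple

variable {p q r n : ℕ}

section

variable (h : DescentTriple p q r n)
include h

lemma q_pos : (0 : ℚ) < q := by exact_mod_cast h.prime_q.pos

lemma p_pos : (0 : ℚ) < p := by exact_mod_cast h.prime_p.pos

lemma r_pos : (0 : ℚ) < r := by exact_mod_cast h.prime_r.pos

lemma n_pos' : (0 : ℚ) < n := by exact_mod_cast h.n_pos

lemma q_eq' : (q : ℚ) = p + 16 * n ^ 2 := by exact_mod_cast h.q_eq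

lemma r_eq' : (r : ℚ) = q + 9 * n ^ 2 := by exact_mod_cast h.r_eq

lemma b_ne_zero : 4 * (q : ℚ) * r ≠ 0 := by
  have := h.q_pos
  have := h.r_pos
  positivity

lemma disc_eq : (-(5 * (q : ℚ))) ^ 2 - 4 * (4 * q * r) = 9 * p * q := by
  rw [h.r_eq']
  linear_combination 9 * (q : ℚ) * h.q_eq'

lemma disc_ne_zero : (-(5 * (q : ℚ))) ^ 2 - 4 * (4 * q * r) ≠ 0 := by
  rw [h.disc_eq]
  have := h.q_pos
  have := h.p_pos
  positivity

lemma q_ne_sq (t : ℚ) : (q : ℚ) ≠ t ^ 2 := by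
  intro e
  have : IsSquare (q : ℚ) := ⟨t, by rw [e, sq]⟩
  rw [Rat.isSquare_natCast_iff] at this
  exact h.prime_q.prime.not_isSquare this

lemma r_ne_sq (t : ℚ) : (r : ℚ) ≠ t ^ 2 := by
  intro e
  have : IsSquare (r : ℚ) := ⟨t, by rw [e, sq]⟩
  rw [Rat.isSquare_natCast_iff] at this
  exact h.prime_r.prime.not_isSquare this

lemma qr_ne_sq (t : ℚ) : (q : ℚ) * r ≠ t ^ 2 := by
  refine Nat.Prime.mul_cast_ne_sq h.prime_q h.prime_r ?_ t
  have := h.r_eq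
  have := h.n_pos
  have : 0 < n ^ 2 := by positivity
  omega

lemma pq_ne_sq (t : ℚ) : (p : ℚ) * q ≠ t ^ 2 := by
  refine Nat.Prime.mul_cast_ne_sq h.prime_p h.prime_q ?_ t
  have := h.q_eq
  have := h.n_pos
  have : 0 < n ^ 2 := by positivity
  omega

end

/-- The curve `y² = x³ - 5qx² + 4qrx`. -/
abbrev curve (q r : ℕ) : Affine ℚ :=
  (twoTorsionCurve (-(5 * (q : ℚ))) (4 * q * r)).toAffine

variable (h : DescentTriple p q r n)
include h

lemma nonsingular_zero : (curve q r).Nonsingular 0 0 :=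
  twoTorsionCurve.nonsingular h.b_ne_zero h.disc_ne_zero (by ring)

lemma nonsingular_q : (curve q r).Nonsingular q (6 * q * n) :=
  twoTorsionCurve.nonsingular h.b_ne_zero h.disc_ne_zero (by rw [h.r_eq']; ring)

lemma nonsingular_four_q : (curve q r).Nonsingular (4 * q) (12 * q * n) :=
  twoTorsionCurve.nonsingular h.b_ne_zero h.disc_ne_zero (by rw [h.r_eq']; ring)

/-- The rational point `(0, 0)` of order two. -/
def pointT : (curve q r).Point := .some _ _ h.nonsingular_zero

/-- The rational point `(q, 6qn)`. -/
def pointP : (curve q r).Point := .some _ _ h.nonsingular_q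

/-- The rational point `(4q, 12qn)`. -/
def pointQ : (curve q r).Point := .some _ _ h.nonsingular_four_q

lemma eq_pointT {y : ℚ} (hy : (curve q r).Nonsingular 0 y) : .some 0 y hy = h.pointT := by
  have := twoTorsionCurve.eq_of_nonsingular hy
  obtain rfl : y = 0 := by simpa using this
  rfl

lemma y_ne_zero {x y : ℚ} (hxy : (curve q r).Nonsingular x y) (hx : x ≠ 0) : y ≠ 0 := by
  rintro rfl
  have e := twoTorsionCurve.eq_of_nonsingular hxy
  have : x ^ 2 - 5 * q * x + 4 * q * r = 0 := by
    apply mul_left_cancel₀ hx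
    linear_combination -e
  apply h.pq_ne_sq ((2 * x - 5 * q) / 3)
  linear_combination (-4 / 9 : ℚ) * this - h.disc_eq / 9

lemma pointP_add_pointQ :
    ∃ h', h.pointP + h.pointQ =
      Affine.Point.some ((2 * n : ℚ) ^ 2) (2 * n * (-2 * (q + 2 * n ^ 2))) h' := by
  have hq := h.q_pos
  have hq' : (q : ℚ) ≠ 4 * q := by
    intro e
    linarith
  refine twoTorsionCurve.some_add_some _ _ hq' (l := 2 * n) ?_ ?_ ?_
  · have : (q : ℚ) - 4 * q ≠ 0 := sub_ne_zero.mpr hq'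
    field_simp
    ring
  · ring
  · ring

/-! ### Independence modulo doubles -/

lemma pointT_not_double (R : (curve q r).Point) : R + R ≠ h.pointT := by
  intro e
  obtain ⟨X, S, -, hS, e⟩ := twoTorsionCurve.exists_of_add_self e
  apply h.qr_ne_sq ((S ^ 2 + 5 * q) / 4)
  linear_combination e / 16

lemma pointP_not_double (R : (curve q r).Point) : R + R ≠ h.pointP := by
  intro e
  obtain ⟨X, S, hX, -⟩ := twoTorsionCurve.exists_of_add_self e
  exact h.q_ne_sq X hX

lemma pointQ_not_double (R : (curve q r).Point) : R + R ≠ h.pointQ := by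
  intro e
  obtain ⟨X, S, hX, -⟩ := twoTorsionCurve.exists_of_add_self e
  apply h.q_ne_sq (X / 2)
  linear_combination hX / 4

lemma pointP_add_pointT_not_double (R : (curve q r).Point) : R + R ≠ h.pointP + h.pointT := by
  obtain ⟨h', e'⟩ := twoTorsionCurve.some_add_origin h.nonsingular_q h.nonsingular_zero h.q_pos.ne'
  intro e
  obtain ⟨X, S, hX, -⟩ := twoTorsionCurve.exists_of_add_self (e.trans e')
  have := h.q_pos
  apply h.r_ne_sq (X / 2)
  field_simp at hX
  linear_combination hX / 4

lemma pointQ_add_pointT_not_double (R : (curve q r).Point) : R + R ≠ h.pointQ + h.pointT := by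
  have := h.q_pos
  obtain ⟨h', e'⟩ := twoTorsionCurve.some_add_origin h.nonsingular_four_q h.nonsingular_zero
    (by positivity)
  intro e
  obtain ⟨X, S, hX, -⟩ := twoTorsionCurve.exists_of_add_self (e.trans e')
  apply h.r_ne_sq X
  field_simp at hX
  linear_combination hX

lemma pointP_add_pointQ_not_double (R : (curve q r).Point) : R + R ≠ h.pointP + h.pointQ := by
  obtain ⟨h', e'⟩ := h.pointP_add_pointQ
  intro e
  obtain ⟨X, S, -, -, hS⟩ := twoTorsionCurve.exists_of_add_self (e.trans e')
  have hq := h.q_pos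
  have hp := h.p_pos
  have : (S ^ 2 + 9 * q) * (S ^ 2 + p) = 0 := by
    rw [h.r_eq'] at hS
    linear_combination -hS - (S ^ 2 + 9 * q) * h.q_eq'
  have h2 : 0 < (S ^ 2 + 9 * q) * (S ^ 2 + p) := by positivity
  exact h2.ne' this

lemma pointP_add_pointQ_add_pointT_not_double (R : (curve q r).Point) :
    R + R ≠ h.pointP + h.pointQ + h.pointT := by
  obtain ⟨h₁, e₁⟩ := h.pointP_add_pointQ
  have := h.n_pos'
  obtain ⟨h', e'⟩ := twoTorsionCurve.some_add_origin h₁ h.nonsingular_zero (by positivity)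
  intro e
  rw [e₁] at e
  obtain ⟨X, S, hX, -⟩ := twoTorsionCurve.exists_of_add_self (e.trans e')
  apply h.qr_ne_sq (X * n)
  field_simp at hX
  linear_combination hX / 4

/-! ### Generation modulo doubles -/

section

variable {H : AddSubgroup (curve q r).Point}

lemma mem_of_eq_neg_q_mul_sq (hH : ∀ R, R + R ∈ H) (hP : h.pointP ∈ H) (hQ : h.pointQ ∈ H)
    {X Z k : ℚ} (hX : X ≠ 0) (h' : (curve q r).Nonsingular (X ^ 2) (X * Z))
    (hk : 2 * X ^ 2 - 5 * q + 2 * Z = -q * k ^ 2) : .some _ _ h' ∈ H := by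
  obtain ⟨h₁, e₁⟩ := h.pointP_add_pointQ
  have hR : Affine.Point.some _ _ h₁ ∈ H := e₁ ▸ H.add_mem hP hQ
  by_cases hXn : X ^ 2 = (2 * n) ^ 2
  · rcases Affine.Point.X_eq_iff (h₁ := h') (h₂ := h₁).mp hXn with e | e
    · rwa [e]
    · rw [e]
      exact H.neg_mem hR
  · have hn : (2 * n : ℚ) ≠ 0 := by
      have := h.n_pos'
      positivity
    obtain ⟨R, e⟩ := twoTorsionCurve.exists_add_self_of_mul_eq_sq h.b_ne_zero h.disc_ne_zero
      h' h₁ hX hn hXn rfl rfl (k := 3 * q * k) (by linear_combination (-9) * q * hk)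
    refine (H.add_mem_cancel_right hR).mp ?_
    rw [← e]
    exact hH R

lemma mem_of_eq_sq (hH : ∀ R, R + R ∈ H) (hP : h.pointP ∈ H) (hQ : h.pointQ ∈ H) {X x y : ℚ}
    (hX : X ≠ 0) (hx : x = X ^ 2) (h' : (curve q r).Nonsingular x y) : .some _ _ h' ∈ H := by
  obtain ⟨Z, rfl⟩ : ∃ Z, y = X * Z := ⟨y / X, by field_simp⟩
  subst hx
  have hq := h.q_pos
  have hp := h.p_pos
  have hZ : Z ^ 2 = X ^ 4 - 5 * q * X ^ 2 + 4 * q * r := by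
    have := twoTorsionCurve.eq_of_nonsingular h'
    apply mul_left_cancel₀ (pow_ne_zero 2 hX)
    linear_combination this
  have hmul : (2 * X ^ 2 - 5 * q + 2 * Z) * (2 * X ^ 2 - 5 * q - 2 * Z) = 9 * p * q := by
    linear_combination (-4) * hZ + h.disc_eq
  have hs0 : 2 * X ^ 2 - 5 * q + 2 * Z ≠ 0 := by
    refine left_ne_zero_of_mul (b := 2 * X ^ 2 - 5 * q - 2 * Z) ?_
    rw [hmul]
    positivity
  obtain ⟨k, hk, hs⟩ := exists_sq_class_of_dual_equation (p := p) (q := q)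
    (y := 2 * X * (2 * X ^ 2 - 5 * q + 2 * Z))
    h.prime_p h.prime_q h.p_mod_three h.q_mod_three (by have := h.q_mod_eight; omega) h.n_pos
    h.q_eq hs0 (by
      linear_combination (2 * X ^ 2 - 5 * q + 2 * Z) * (h.disc_eq - 4 * hZ))
  have hdouble : ∀ {S : ℚ}, 4 * X ^ 2 * S ^ 2 = (S ^ 2 - -(5 * (q : ℚ))) ^ 2 - 4 * (4 * q * r) →
      Affine.Point.some _ _ h' ∈ H := by
    intro S hS
    obtain ⟨R, e⟩ := twoTorsionCurve.exists_add_self h.b_ne_zero h.disc_ne_zero h' rfl hS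
    rw [← e]
    exact hH R
  rcases hs with hs | hs | hs | hs
  · refine hdouble (S := k) ?_
    rw [← hs]
    linear_combination (-4) * hZ
  · refine hdouble (S := 3 / k) ?_
    have : (3 / k) ^ 2 = 2 * X ^ 2 - 5 * q - 2 * Z := by
      rw [hs] at hmul
      field_simp
      apply mul_left_cancel₀ (mul_pos hp hq).ne'
      linear_combination -hmul
    rw [this]
    linear_combination (-4) * hZ
  · obtain ⟨h'', e⟩ := twoTorsionCurve.neg_some h'
    obtain ⟨h₃, e₃⟩ := twoTorsionCurve.some_congr h'' rfl (neg_mul_eq_mul_neg X Z)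
    rw [← H.neg_mem_iff, e, e₃]
    refine h.mem_of_eq_neg_q_mul_sq hH hP hQ hX h₃ (k := 3 / k) ?_
    rw [hs] at hmul
    field_simp
    apply mul_left_cancel₀ hp.ne'
    linear_combination -hmul
  · exact h.mem_of_eq_neg_q_mul_sq hH hP hQ hX h' hs

lemma mem_of_eq_q_mul_sq (hH : ∀ R, R + R ∈ H) (hT : h.pointT ∈ H) (hP : h.pointP ∈ H)
    (hQ : h.pointQ ∈ H) {X x y : ℚ} (hX : X ≠ 0) (hx : x = q * X ^ 2)
    (h' : (curve q r).Nonsingular x y) : .some _ _ h' ∈ H := by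
  have hq := h.q_pos
  by_cases hxq : x = q
  · rcases Affine.Point.X_eq_iff (h₁ := h') (h₂ := h.nonsingular_q).mp hxq with e | e
    · rw [e]
      exact hP
    · rw [e]
      exact H.neg_mem hP
  · refine (H.add_mem_cancel_right hP).mp ?_
    obtain ⟨x₃, y₃, h₃, k, e, hk⟩ := twoTorsionCurve.exists_some_add_some_mul h' h.nonsingular_q hxq
    rw [pointP, e]
    rcases eq_or_ne x₃ 0 with rfl | h0
    · rw [h.eq_pointT h₃]
      exact hT
    · have hx₃ : x₃ = (k / (q * X)) ^ 2 := by
        rw [hx] at hk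
        field_simp
        linear_combination hk
      refine h.mem_of_eq_sq hH hP hQ ?_ hx₃ h₃
      intro h1
      apply h0
      rw [hx₃, h1]
      ring

theorem mem_of_pointT_pointP_pointQ (hH : ∀ R, R + R ∈ H) (hT : h.pointT ∈ H)
    (hP : h.pointP ∈ H) (hQ : h.pointQ ∈ H) (R : (curve q r).Point) : R ∈ H := by
  match R with
  | 0 => exact H.zero_mem
  | .some x y h' =>
    rcases eq_or_ne x 0 with rfl | hx
    · rw [h.eq_pointT h']
      exact hT
    · obtain ⟨h₃, e⟩ := twoTorsionCurve.some_add_origin h' h.nonsingular_zero hx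
      have hq := h.q_pos
      have hr := h.r_pos
      obtain ⟨t, ht, e' | e' | e' | e'⟩ := exists_sq_class_of_equation h.prime_q h.prime_r
        h.q_mod_eight h.r_mod_eight hx (twoTorsionCurve.eq_of_nonsingular h')
      · exact h.mem_of_eq_sq hH hP hQ ht e' h'
      · exact h.mem_of_eq_q_mul_sq hH hT hP hQ ht e' h'
      · refine (H.add_mem_cancel_right hT).mp ?_
        rw [pointT, e]
        refine h.mem_of_eq_q_mul_sq hH hT hP hQ (X := 2 / t) (by positivity) ?_ h₃
        rw [e']
        field_simp
        norm_num
      · refine (H.add_mem_cancel_right hT).mp ?_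
        rw [pointT, e]
        refine h.mem_of_eq_sq hH hP hQ (X := 2 / t) (by positivity) ?_ h₃
        rw [e']
        field_simp
        norm_num

end

end DescentTriple

namespace twoTorsionCurve

variable {a b : ℚ}

lemma exists_add_self_padicNorm (ha : padicNorm 2 a ≤ 1) (hb : padicNorm 2 b ≤ 1) {x y : ℚ}
    (h : (twoTorsionCurve a b).toAffine.Nonsingular x y) (hx : 1 < padicNorm 2 x) :
    ∃ x' y' h', Affine.Point.some x y h + Affine.Point.some x y h = Affine.Point.some x' y' h' ∧
      padicNorm 2 x' = 4 * padicNorm 2 x := by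
  have hy2 : padicNorm 2 y ^ 2 = padicNorm 2 x ^ 3 := by
    have h1 : padicNorm 2 (a * x ^ 2 + b * x) < padicNorm 2 (x ^ 3) := by
      refine padicNorm.nonarchimedean.trans_lt (max_lt ?_ ?_)
      · simp only [padicNorm.mul, IsAbsoluteValue.abv_pow (padicNorm 2)]
        exact (mul_le_of_le_one_left (by positivity) ha).trans_lt
          (pow_lt_pow_right₀ hx (by norm_num))
      · simp only [padicNorm.mul, IsAbsoluteValue.abv_pow (padicNorm 2)]
        exact (mul_le_of_le_one_left (by positivity) hb).trans_lt
          (lt_self_pow₀ hx (by norm_num))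
    rw [← IsAbsoluteValue.abv_pow (padicNorm 2), eq_of_nonsingular h, add_assoc,
      padicNorm.add_eq_max_of_ne h1.ne', max_eq_left h1.le, IsAbsoluteValue.abv_pow (padicNorm 2)]
  have hx0 : padicNorm 2 x ≠ 0 := by positivity
  have hy : y ≠ 0 := by
    rintro rfl
    apply pow_ne_zero 3 hx0
    rw [← hy2]
    simp
  have hxb : padicNorm 2 (x ^ 2 - b) = padicNorm 2 x ^ 2 := by
    have h1 : padicNorm 2 (-b) < padicNorm 2 (x ^ 2) := by
      rw [padicNorm.neg, IsAbsoluteValue.abv_pow (padicNorm 2)]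
      nlinarith
    rw [sub_eq_add_neg, padicNorm.add_eq_max_of_ne h1.ne', max_eq_left h1.le,
      IsAbsoluteValue.abv_pow (padicNorm 2)]
  obtain ⟨y', h', e⟩ := some_add_self h hy
  refine ⟨_, y', h', e, ?_⟩
  have h2 : padicNorm 2 2 = 2⁻¹ := by simpa using padicNorm.padicNorm_p (p := 2) one_lt_two
  rw [IsAbsoluteValue.abv_pow (padicNorm 2), padicNorm.div, padicNorm.mul, hxb, div_pow, mul_pow,
    hy2, h2]
  field_simp
  norm_num

lemma not_isOfFinAddOrder_of_one_lt_padicNorm (ha : padicNorm 2 a ≤ 1) (hb : padicNorm 2 b ≤ 1)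
    {x y : ℚ} (h : (twoTorsionCurve a b).toAffine.Nonsingular x y) (hx : 1 < padicNorm 2 x) :
    ¬ IsOfFinAddOrder (Affine.Point.some x y h) := by
  have key : ∀ k : ℕ, ∃ x' y' h', (2 ^ k) • Affine.Point.some x y h = Affine.Point.some x' y' h' ∧
      padicNorm 2 x' = 4 ^ k * padicNorm 2 x := by
    intro k
    induction k with
    | zero => exact ⟨x, y, h, by simp, by simp⟩
    | succ k ih =>
      obtain ⟨x₁, y₁, h₁, e₁, hx₁⟩ := ih
      have : 1 < padicNorm 2 x₁ := by
        rw [hx₁]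
        have : (1 : ℚ) ≤ 4 ^ k := one_le_pow₀ (by norm_num)
        nlinarith
      obtain ⟨x₂, y₂, h₂, e₂, hx₂⟩ := exists_add_self_padicNorm ha hb h₁ this
      refine ⟨x₂, y₂, h₂, ?_, ?_⟩
      · rw [pow_succ, mul_smul, two_nsmul, nsmul_add, e₁, e₂]
      · rw [hx₂, hx₁]
        ring
  rw [← finite_zmultiples]
  refine Set.infinite_of_injective_forall_mem (f := fun k : ℕ ↦ (2 ^ k) • Affine.Point.some x y h)
    ?_ fun k ↦ AddSubgroup.nsmul_mem_zmultiples _ _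
  intro i j hij
  obtain ⟨x₁, y₁, h₁, e₁, hx₁⟩ := key i
  obtain ⟨x₂, y₂, h₂, e₂, hx₂⟩ := key j
  simp only [e₁, e₂, Affine.Point.some.injEq] at hij
  rw [hij.1, hx₂] at hx₁
  have hx0 : padicNorm 2 x ≠ 0 := by positivity
  exact (pow_right_injective₀ (by norm_num) (by norm_num) (mul_right_cancel₀ hx0 hx₁)).symm

lemma exists_add_self_of_padicNorm_le (ha : padicNorm 2 a ≤ 1) (hb : padicNorm 2 b = 4⁻¹)
    {x y w : ℚ} (h : (twoTorsionCurve a b).toAffine.Nonsingular x y) (hxw : x = w ^ 2) (hy : y ≠ 0)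
    (hx : padicNorm 2 x ≤ 1) :
    ∃ x' y' h', Affine.Point.some x y h + Affine.Point.some x y h = Affine.Point.some x' y' h' ∧
      1 < padicNorm 2 x' := by
  obtain ⟨y', h', e⟩ := some_add_self h hy
  refine ⟨_, y', h', e, ?_⟩
  have h2 : padicNorm 2 2 = 2⁻¹ := by simpa using padicNorm.padicNorm_p (p := 2) one_lt_two
  have hy0 : padicNorm 2 y ≠ 0 := padicNorm.nonzero hy
  have hyp : 0 < padicNorm 2 y ^ 2 := by positivity
  have hy2 : padicNorm 2 y ^ 2 = padicNorm 2 x * padicNorm 2 (x ^ 2 + (a * x + b)) := by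
    rw [← padicNorm.mul, ← IsAbsoluteValue.abv_pow (padicNorm 2), eq_of_nonsingular h]
    congr 1
    ring
  have hx0 : 0 ≤ padicNorm 2 x := padicNorm.nonneg _
  rw [IsAbsoluteValue.abv_pow (padicNorm 2), padicNorm.div, padicNorm.mul, div_pow, mul_pow, h2,
    one_lt_div (by positivity)]
  have hw : padicNorm 2 x = padicNorm 2 w ^ 2 := by
    rw [hxw, IsAbsoluteValue.abv_pow (padicNorm 2)]
  rcases eq_or_lt_of_le hx with hx1 | hx1
  · have h3 : padicNorm 2 (-b) < padicNorm 2 (x ^ 2) := by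
      rw [padicNorm.neg, IsAbsoluteValue.abv_pow (padicNorm 2), hb, hx1]
      norm_num
    rw [sub_eq_add_neg, padicNorm.add_eq_max_of_ne h3.ne', max_eq_left h3.le,
      IsAbsoluteValue.abv_pow (padicNorm 2), hx1]
    have h4 : padicNorm 2 (x ^ 2 + (a * x + b)) ≤ 1 := by
      refine padicNorm.nonarchimedean.trans (max_le ?_
        (padicNorm.nonarchimedean.trans (max_le ?_ ?_)))
      · simp [IsAbsoluteValue.abv_pow (padicNorm 2), hx1]
      · simpa [padicNorm.mul, hx1] using ha
      · rw [hb]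
        norm_num
    rw [hy2, hx1]
    linarith
  · have hx4 : padicNorm 2 x ≤ 4⁻¹ := by
      have hw0 : w ≠ 0 := by
        rintro rfl
        rw [hy2, hw] at hyp
        simp at hyp
      obtain ⟨z, hz⟩ := padicNorm.values_discrete (p := 2) hw0
      have hw1 : padicNorm 2 w < 1 := by
        rw [hw] at hx1
        nlinarith [padicNorm.nonneg (p := 2) w]
      rw [hz] at hw1
      have hz1 : -z < 0 := by
        by_contra h0
        exact hw1.not_ge (one_le_zpow₀ (by norm_num) (not_lt.mp h0))
      have hw2 : padicNorm 2 w ≤ 2⁻¹ := by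
        rw [hz, ← zpow_neg_one]
        exact zpow_le_zpow_right₀ (by norm_num) (by omega)
      rw [hw]
      nlinarith [padicNorm.nonneg (p := 2) w]
    have h3 : padicNorm 2 (x ^ 2) < padicNorm 2 (-b) := by
      rw [padicNorm.neg, IsAbsoluteValue.abv_pow (padicNorm 2), hb]
      nlinarith
    rw [sub_eq_add_neg, padicNorm.add_eq_max_of_ne h3.ne, max_eq_right h3.le, padicNorm.neg, hb]
    have h4 : padicNorm 2 (x ^ 2 + (a * x + b)) ≤ 4⁻¹ := by
      refine padicNorm.nonarchimedean.trans (max_le ?_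
        (padicNorm.nonarchimedean.trans (max_le ?_ ?_)))
      · rw [IsAbsoluteValue.abv_pow (padicNorm 2)]
        nlinarith
      · rw [padicNorm.mul]
        nlinarith [padicNorm.nonneg (p := 2) a]
      · exact hb.le
    have h5 : padicNorm 2 y ^ 2 ≤ 4⁻¹ * 4⁻¹ := by
      rw [hy2]
      exact mul_le_mul hx4 h4 (padicNorm.nonneg _) (by norm_num)
    linarith

end twoTorsionCurve

namespace DescentTriple

variable {p q r n : ℕ} (h : DescentTriple p q r n)
include h

lemma pointT_ne_zero : h.pointT ≠ 0 := Affine.Point.some_ne_zero _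

lemma pointT_add_pointT : h.pointT + h.pointT = 0 :=
  twoTorsionCurve.some_add_self_eq_zero h.nonsingular_zero rfl

theorem isOfFinAddOrder_iff (R : (curve q r).Point) :
    IsOfFinAddOrder R ↔ R = 0 ∨ R = h.pointT := by
  constructor
  · intro hR
    by_contra! hR'
    have ha : padicNorm 2 (-(5 * (q : ℚ))) ≤ 1 := by
      exact_mod_cast padicNorm.of_int (p := 2) (-(5 * (q : ℤ)))
    have hb : padicNorm 2 (4 * (q : ℚ) * r) = 4⁻¹ := by
      have h2 : padicNorm 2 2 = 2⁻¹ := by simpa using padicNorm.padicNorm_p (p := 2) one_lt_two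
      have hq : padicNorm 2 (q : ℚ) = 1 := by
        rw [padicNorm.nat_eq_one_iff]
        have := h.q_mod_eight
        omega
      have hr : padicNorm 2 (r : ℚ) = 1 := by
        rw [padicNorm.nat_eq_one_iff]
        have := h.r_mod_eight
        omega
      rw [padicNorm.mul, padicNorm.mul, hq, hr, show (4 : ℚ) = 2 * 2 by norm_num, padicNorm.mul, h2]
      norm_num
    have hb1 : padicNorm 2 (4 * (q : ℚ) * r) ≤ 1 := by
      rw [hb]
      norm_num
    match R with
    | 0 => exact hR'.1 rfl
    | .some x y h' =>
      have hy : y ≠ 0 := by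
        refine h.y_ne_zero h' ?_
        rintro rfl
        exact hR'.2 (h.eq_pointT h')
      obtain ⟨y₁, h₁, e₁⟩ := twoTorsionCurve.some_add_self h' hy
      have hR₁ := hR.add hR
      rw [e₁] at hR₁
      have hx₁ := not_lt.mp fun hx ↦
        twoTorsionCurve.not_isOfFinAddOrder_of_one_lt_padicNorm ha hb1 h₁ hx hR₁
      have hy₁ : y₁ ≠ 0 := by
        refine h.y_ne_zero h₁ fun h0 ↦ ?_
        obtain ⟨h₂, e₂⟩ := twoTorsionCurve.some_congr h₁ h0 rfl
        exact h.pointT_not_double _ (e₁.trans (e₂.trans (h.eq_pointT h₂)))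
      obtain ⟨x₂, y₂, h₂, e₂, hx₂⟩ :=
        twoTorsionCurve.exists_add_self_of_padicNorm_le ha hb h₁ rfl hy₁ hx₁
      have hR₂ := hR₁.add hR₁
      rw [e₂] at hR₂
      exact twoTorsionCurve.not_isOfFinAddOrder_of_one_lt_padicNorm ha hb1 h₂ hx₂ hR₂
  · rintro (rfl | rfl)
    · exact IsOfFinAddOrder.zero
    · exact isOfFinAddOrder_iff_nsmul_eq_zero.mpr
        ⟨2, two_pos, by rw [two_nsmul, h.pointT_add_pointT]⟩

end DescentTriple

section

variable {G : Type*} [AddCommGroup G] {T P Q : G}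

/-- If `T`, `P`, `Q` form a basis of `G / 2G`, then `G / 2G` has order eight. -/
lemma card_eq_eight_of_basis_mod_two {V : Type*} [AddCommGroup V] [Module (ZMod 2) V] (f : G →+ V)
    (hf : Function.Surjective f) (hker : ∀ x, f x = 0 → ∃ y, y + y = x)
    (hgen : ∀ H : AddSubgroup G, (∀ x, x + x ∈ H) → T ∈ H → P ∈ H → Q ∈ H → ∀ x, x ∈ H)
    (hind : ∀ (i j k : ZMod 2) (y : G), y + y = i.val • T + j.val • P + k.val • Q →
      i = 0 ∧ j = 0 ∧ k = 0) : Nat.card V = 8 := by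
  let φ : (ZMod 2 × ZMod 2 × ZMod 2) →ₗ[ZMod 2] V :=
    (LinearMap.toSpanSingleton (ZMod 2) V (f T)).coprod
      ((LinearMap.toSpanSingleton (ZMod 2) V (f P)).coprod
        (LinearMap.toSpanSingleton (ZMod 2) V (f Q)))
  have hφ : ∀ i j k, φ (i, j, k) = i • f T + (j • f P + k • f Q) := fun i j k ↦ rfl
  have hsmul : ∀ (i : ZMod 2) (x : G), i • f x = f (i.val • x) := by
    intro i x
    rw [map_nsmul, ← Nat.cast_smul_eq_nsmul (ZMod 2), ZMod.natCast_zmod_val]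
  have hinj : Function.Injective φ := by
    rw [injective_iff_map_eq_zero]
    rintro ⟨i, j, k⟩ h0
    rw [hφ, hsmul, hsmul, hsmul, ← map_add, ← map_add, ← add_assoc] at h0
    obtain ⟨y, hy⟩ := hker _ h0
    obtain ⟨rfl, rfl, rfl⟩ := hind i j k y hy
    rfl
  have hsurj : Function.Surjective φ := by
    intro v
    obtain ⟨x, rfl⟩ := hf v
    refine hgen ((LinearMap.range φ).toAddSubgroup.comap f) ?_ ?_ ?_ ?_ x
    · intro x
      refine ⟨0, ?_⟩
      rw [map_zero, map_add, ← two_smul (ZMod 2) (f x), show (2 : ZMod 2) = 0 from rfl, zero_smul]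
    · exact ⟨(1, 0, 0), by simp [hφ]⟩
    · exact ⟨(0, 1, 0), by simp [hφ]⟩
    · exact ⟨(0, 0, 1), by simp [hφ]⟩
  rw [← Nat.card_congr (Equiv.ofBijective φ ⟨hinj, hsurj⟩)]
  simp

lemma finiteIndex_range_two
    (hgen : ∀ H : AddSubgroup G, (∀ x, x + x ∈ H) → T ∈ H → P ∈ H → Q ∈ H → ∀ x, x ∈ H)
    (hind : ∀ (i j k : ZMod 2) (y : G), y + y = i.val • T + j.val • P + k.val • Q →
      i = 0 ∧ j = 0 ∧ k = 0) : (nsmulAddMonoidHom (α := G) 2).range.FiniteIndex := by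
  let _ : Module (ZMod 2) (G ⧸ (nsmulAddMonoidHom (α := G) 2).range) :=
    AddCommGroup.zmodModule (by
      intro x
      obtain ⟨x, rfl⟩ := QuotientAddGroup.mk_surjective x
      rw [← QuotientAddGroup.mk_nsmul, QuotientAddGroup.eq_zero_iff]
      exact ⟨x, rfl⟩)
  have := card_eq_eight_of_basis_mod_two
    (QuotientAddGroup.mk' (nsmulAddMonoidHom (α := G) 2).range)
    (QuotientAddGroup.mk'_surjective _) (by
      intro x hx
      rw [QuotientAddGroup.mk'_apply, QuotientAddGroup.eq_zero_iff] at hx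
      obtain ⟨y, rfl⟩ := hx
      exact ⟨y, (two_nsmul y).symm⟩) hgen hind
  exact ⟨by rw [AddSubgroup.index, this]; norm_num⟩

lemma exists_addEquiv_of_torsion_of_basis_mod_two [AddGroup.FG G] (hT : T ≠ 0)
    (htors : ∀ x : G, IsOfFinAddOrder x ↔ x = 0 ∨ x = T)
    (hgen : ∀ H : AddSubgroup G, (∀ x, x + x ∈ H) → T ∈ H → P ∈ H → Q ∈ H → ∀ x, x ∈ H)
    (hind : ∀ (i j k : ZMod 2) (y : G), y + y = i.val • T + j.val • P + k.val • Q →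
      i = 0 ∧ j = 0 ∧ k = 0) : Nonempty (G ≃+ ZMod 2 × ℤ × ℤ) := by
  obtain ⟨r, ι, _, p, hp, e, ⟨g⟩⟩ := AddCommGroup.equiv_free_prod_directSum_zmod G
  have : ∀ i, NeZero (p i ^ e i) := fun i ↦ ⟨pow_ne_zero _ (hp i).ne_zero⟩
  have : Finite (DirectSum ι fun i ↦ ZMod (p i ^ e i)) := by
    classical
    exact Finite.of_equiv _ (DirectSum.addEquivProd fun i ↦ ZMod (p i ^ e i)).symm.toEquiv
  have hcard : Nat.card (DirectSum ι fun i ↦ ZMod (p i ^ e i)) = 2 := by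
    have hT' : (g T).1 = 0 := by
      obtain ⟨n, hn, h0⟩ := isOfFinAddOrder_iff_nsmul_eq_zero.mp ((htors T).mpr (Or.inr rfl))
      have h1 : n • (g T).1 = 0 := by rw [← Prod.smul_fst, ← map_nsmul, h0, map_zero]; rfl
      ext i
      have h2 := DFunLike.congr_fun h1 i
      rw [Finsupp.smul_apply, Finsupp.zero_apply, smul_eq_zero] at h2
      exact h2.resolve_left hn.ne'
    rw [Nat.card_eq_two_iff]
    refine ⟨0, (g T).2, ?_, ?_⟩
    · intro h0
      apply hT
      rw [← g.map_eq_zero_iff]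
      exact Prod.ext hT' h0.symm
    · ext t
      simp only [Set.mem_insert_iff, Set.mem_singleton_iff, Set.mem_univ, iff_true]
      have h1 : IsOfFinAddOrder (g.symm (0, t)) :=
        (g.symm.toAddMonoidHom.comp (AddMonoidHom.inr _ _)).isOfFinAddOrder
          (isOfFinAddOrder_of_finite t)
      rcases (htors _).mp h1 with h | h
      · left
        rw [g.symm.map_eq_zero_iff] at h
        exact congrArg Prod.snd h
      · right
        rw [← h, g.apply_symm_apply]
  have : Fact (Nat.Prime 2) := ⟨Nat.prime_two⟩
  have hcyc : IsAddCyclic (DirectSum ι fun i ↦ ZMod (p i ^ e i)) := isAddCyclic_of_prime_card hcard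
  have g₂ : ZMod 2 ≃+ (DirectSum ι fun i ↦ ZMod (p i ^ e i)) :=
    (ZMod.ringEquivCongr hcard.symm).toAddEquiv.trans (zmodAddCyclicAddEquiv hcyc)
  have g' : G ≃+ (Fin r → ℤ) × ZMod 2 :=
    g.trans ((Finsupp.linearEquivFunOnFinite ℤ ℤ (Fin r)).toAddEquiv.prodCongr g₂.symm)
  let f : G →+ (Fin r → ZMod 2) × ZMod 2 :=
    (AddMonoidHom.prodMap ((Int.castAddHom (ZMod 2)).compLeft (Fin r))
      (AddMonoidHom.id (ZMod 2))).comp g'.toAddMonoidHom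
  have hf : ∀ x, f x = (fun i ↦ ((g' x).1 i : ZMod 2), (g' x).2) := fun x ↦ rfl
  have h8 := card_eq_eight_of_basis_mod_two f (T := T) (P := P) (Q := Q) ?_ ?_ hgen hind
  · have hr : r = 2 := by
      rw [Nat.card_prod, Nat.card_fun, Nat.card_zmod, Nat.card_fin] at h8
      have : 2 ^ r = 2 ^ 2 := by omega
      exact Nat.pow_right_injective le_rfl this
    subst hr
    exact ⟨g'.trans (AddEquiv.prodComm.trans ((AddEquiv.refl _).prodCongr
      (LinearEquiv.finTwoArrow ℤ ℤ).toAddEquiv))⟩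
  · rintro ⟨u, v⟩
    refine ⟨g'.symm (fun i ↦ (u i).val, v), ?_⟩
    rw [hf, g'.apply_symm_apply]
    simp
  · intro x hx
    rw [hf, Prod.mk_eq_zero] at hx
    have h1 : ∀ i, (2 : ℤ) ∣ (g' x).1 i := fun i ↦
      (ZMod.intCast_zmod_eq_zero_iff_dvd _ 2).mp (congrFun hx.1 i)
    choose u hu using h1
    refine ⟨g'.symm (u, 0), ?_⟩
    rw [← map_add, AddEquiv.symm_apply_eq]
    refine Prod.ext ?_ ?_
    · ext i
      simp [hu, two_mul]
    · simp [hx.2]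

end

namespace DescentTriple

variable {p q r n : ℕ} (h : DescentTriple p q r n)
include h

lemma independent_mod_two (i j k : ZMod 2) (R : (curve q r).Point)
    (e : R + R = i.val • h.pointT + j.val • h.pointP + k.val • h.pointQ) :
    i = 0 ∧ j = 0 ∧ k = 0 := by
  have cases : ∀ i : ZMod 2, i = 0 ∨ i = 1 := by decide
  have h1 : (1 : ZMod 2).val = 1 := rfl
  rcases cases i with rfl | rfl <;> rcases cases j with rfl | rfl <;>
    rcases cases k with rfl | rfl <;>
    simp only [ZMod.val_zero, h1, zero_nsmul, one_nsmul, zero_add, add_zero] at e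
  · simp
  · exact absurd e (h.pointQ_not_double R)
  · exact absurd e (h.pointP_not_double R)
  · exact absurd e (h.pointP_add_pointQ_not_double R)
  · exact absurd e (h.pointT_not_double R)
  · exact absurd (e.trans (add_comm _ _)) (h.pointQ_add_pointT_not_double R)
  · exact absurd (e.trans (add_comm _ _)) (h.pointP_add_pointT_not_double R)
  · exact absurd (e.trans (by abel)) (h.pointP_add_pointQ_add_pointT_not_double R)

theorem nonempty_addEquiv : Nonempty ((curve q r).Point ≃+ ZMod 2 × ℤ × ℤ) := by
  have hgen : ∀ H : AddSubgroup (curve q r).Point, (∀ x, x + x ∈ H) → h.pointT ∈ H →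
      h.pointP ∈ H → h.pointQ ∈ H → ∀ x, x ∈ H :=
    fun H hH hT hP hQ x ↦ h.mem_of_pointT_pointP_pointQ hH hT hP hQ x
  have := twoTorsionCurve.fg_of_finiteIndex h.b_ne_zero h.disc_ne_zero
    (finiteIndex_range_two hgen h.independent_mod_two)
  exact exists_addEquiv_of_torsion_of_basis_mod_two h.pointT_ne_zero h.isOfFinAddOrder_iff hgen
    h.independent_mod_two

end DescentTriple

theorem mordell_weil_group_of_zywinaCurve (m n : ℕ) (hm : 0 < m) (hn : 0 < n)
    (hm1 : Nat.Prime m) (hm2 : Nat.Prime (m + 16 * n ^ 2)) (hm3 : Nat.Prime (m + 25 * n ^ 2))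
    (hc1 : m % 24 = 11) (hc2 : (m + 16 * n ^ 2) % 24 = 11) (hc3 : (m + 25 * n ^ 2) % 24 = 11) :
    Nonempty ((zywinaCurve m n).toAffine.Point ≃+ (ZMod 2 × ℤ × ℤ)) := by
  have h : DescentTriple m (m + 16 * n ^ 2) (m + 25 * n ^ 2) n :=
    { prime_p := hm1
      prime_q := hm2
      prime_r := hm3
      n_pos := hn
      q_eq := rfl
      r_eq := by ring
      p_mod_three := by omega
      q_mod_three := by omega
      q_mod_eight := by omega
      r_mod_eight := by omega }
  have e : zywinaCurve m n = DescentTriple.curve (m + 16 * n ^ 2) (m + 25 * n ^ 2) := by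
    simp [zywinaCurve, DescentTriple.curve, twoTorsionCurve]
  rw [e]
  exact h.nonempty_addEquiv
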